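/- Let H be a graph, T ⊆ V(H) a vertex set that is α-well-linked in H for some 0 < α < 1, with H edge-minimal subject to T being α-well-linked. Let Γ ⊆ V(H) \ T be a vertex set that is α'-well-linked in H for some 0 < α' < 1. Then H contains a set of ⌊α'|Γ|/3⌋ edge-disjoint paths connecting vertices of T to vertices of Γ. -/

import Mathlib

attribute [local instance] Classical.propDecidable

noncomputable section

variable {V : Type}

/-- The degree of a vertex `v` in the simple graph `G`. -/
def deg [Fintype V] (G : SimpleGraph V) (v : V) : ℕ :=
  (Finset.univ.filter (fun u => G.Adj v u)).card

/-- The boundary `Γ(C)` of a cluster `C`: the vertices of `C` having a neighbor outside `C`. -/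
def bdry (G : SimpleGraph V) (C : Finset V) : Finset V :=
  C.filter (fun v => ∃ u, u ∉ C ∧ G.Adj v u)

/-- The number of edges `|E(A,B)|` with one endpoint in `A` and the other in `B`
(for disjoint `A`, `B`). -/
def cutCard (G : SimpleGraph V) (A B : Finset V) : ℕ :=
  ((A ×ˢ B).filter (fun ab => G.Adj ab.1 ab.2)).card

/-- A flow in `G[C]` from `A` to `B`, in which every vertex of `A` sends exactly one
unit of flow, every vertex of `B` receives exactly one unit of flow, and the total
flow through any edge is at most `η`. -/
def HasUnitFlowIn (G : SimpleGraph V) (C A B : Finset V) (η : ℝ) : Prop :=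
  ∃ (P : Finset (Σ u v : V, G.Walk u v)) (f : (Σ u v : V, G.Walk u v) → ℝ),
    (∀ p ∈ P, 0 ≤ f p) ∧
    (∀ p ∈ P, p.1 ∈ A ∧ p.2.1 ∈ B) ∧
    (∀ p ∈ P, ∀ x ∈ p.2.2.support, x ∈ C) ∧
    (∀ a ∈ A, ∑ p ∈ P.filter (fun p => p.1 = a), f p = 1) ∧
    (∀ b ∈ B, ∑ p ∈ P.filter (fun p => p.2.1 = b), f p = 1) ∧
    (∀ e : Sym2 V, ∑ p ∈ P.filter (fun p => e ∈ p.2.2.edges), f p ≤ η)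

/-- `T` is `α`-well-linked in `G[C]`: every pair of disjoint equal-sized subsets of `T`
can be connected, one-to-one, by a flow of edge-congestion at most `1/α` inside `C`. -/
def WellLinkedIn (G : SimpleGraph V) (C T : Finset V) (α : ℝ) : Prop :=
  ∀ T' T'' : Finset V, T' ⊆ T → T'' ⊆ T → Disjoint T' T'' → T'.card = T''.card →
    HasUnitFlowIn G C T' T'' (1 / α)

/-- `T` is `(k',α)`-well-linked in `G[C]`. -/
def WellLinkedKIn (G : SimpleGraph V) (C T : Finset V) (k' : ℕ) (α : ℝ) : Prop :=
  ∀ T' T'' : Finset V, T' ⊆ T → T'' ⊆ T → Disjoint T' T'' → T'.card = T''.card →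
    T'.card ≤ k' → HasUnitFlowIn G C T' T'' (1 / α)

/-- `T` is `α`-well-linked in `G`. -/
def WellLinked [Fintype V] (G : SimpleGraph V) (T : Finset V) (α : ℝ) : Prop :=
  WellLinkedIn G Finset.univ T α

/-- There is a family of pairwise vertex-disjoint paths in `G`, one starting at each
vertex of `A`, each ending at a (necessarily distinct) vertex of `B`. -/
def NodeLinkedSets (G : SimpleGraph V) (A B : Finset V) : Prop :=
  ∃ P : Finset (Σ u v : V, G.Walk u v),
    (∀ p ∈ P, p.2.2.IsPath ∧ p.1 ∈ A ∧ p.2.1 ∈ B) ∧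
    (∀ a ∈ A, ∃ p ∈ P, p.1 = a) ∧
    (∀ p ∈ P, ∀ q ∈ P, p ≠ q → ∀ x ∈ p.2.2.support, x ∉ q.2.2.support)

/-- `T` is node-well-linked in `G`. -/
def NodeWellLinked (G : SimpleGraph V) (T : Finset V) : Prop :=
  ∀ T' T'' : Finset V, T' ⊆ T → T'' ⊆ T → Disjoint T' T'' → T'.card = T''.card →
    NodeLinkedSets G T' T''

/-- `(T₁, T₂)` are node-linked in `G`. -/
def NodeLinked (G : SimpleGraph V) (T₁ T₂ : Finset V) : Prop :=
  ∀ T' T'' : Finset V, T' ⊆ T₁ → T'' ⊆ T₂ → T'.card = T''.card → NodeLinkedSets G T' T''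

/-- `(A,B)` is a `ρ`-balanced cut of the cluster `C` with respect to the vertex set `Γ`. -/
def IsBalancedCut (Γ A B C : Finset V) (ρ : ℝ) : Prop :=
  A ∪ B = C ∧ Disjoint A B ∧
    ρ * (Γ.card : ℝ) ≤ ((A ∩ Γ).card : ℝ) ∧ ρ * (Γ.card : ℝ) ≤ ((B ∩ Γ).card : ℝ)

/-! ### Path indicator flows -/

/-- Signed indicator of a walk as an antisymmetric function on ordered pairs. -/
def chi (R : Type) [CommRing R] {G : SimpleGraph V} : ∀ {u v : V}, G.Walk u v → V → V → R
  | _, _, .nil => fun _ _ => 0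
  | _, _, .cons (u := u) (v := v) _ p => fun a b =>
      (if a = u ∧ b = v then 1 else 0) - (if a = v ∧ b = u then 1 else 0) + chi R p a b

lemma chi_antisymm (R : Type) [CommRing R] {G : SimpleGraph V} {u v : V} (w : G.Walk u v)
    (a b : V) : chi R w a b = - chi R w b a := by
  induction w with
  | nil => simp [chi]
  | cons h p ih =>
    simp only [chi]
    rw [ih]
    simp only [and_comm (a := b = _)]
    ring

lemma chi_div (R : Type) [CommRing R] [Fintype V] {G : SimpleGraph V} {u v : V} (w : G.Walk u v)
    (a : V) : ∑ b, chi R w a b = (if a = u then 1 else 0) - (if a = v then 1 else 0) := by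
  induction w with
  | nil => simp [chi]
  | cons h p ih =>
    simp only [chi, Finset.sum_add_distrib, Finset.sum_sub_distrib, ih, ite_and]
    rename_i x y z
    have e1 : ∀ (x y : V), (∑ b : V, if a = x then (if b = y then (1:R) else 0) else 0)
        = if a = x then 1 else 0 := by
      intro x y
      split_ifs <;> simp
    rw [e1, e1]
    ring

lemma chi_zero (R : Type) [CommRing R] {G : SimpleGraph V} {u v : V} (w : G.Walk u v)
    (a b : V) (h : s(a, b) ∉ w.edges) : chi R w a b = 0 := by
  induction w with
  | nil => simp [chi]
  | cons h' p ih =>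
    simp only [SimpleGraph.Walk.edges_cons, List.mem_cons, not_or, Sym2.eq_iff] at h
    simp only [chi]
    rw [ih h.2, if_neg (by tauto), if_neg (by tauto)]
    ring

lemma chi_one (R : Type) [CommRing R] {G : SimpleGraph V} {u v : V} (w : G.Walk u v)
    (hw : w.IsTrail) (d : G.Dart) (h : d ∈ w.darts) : chi R w d.fst d.snd = 1 := by
  induction w with
  | nil => simp at h
  | cons h' p ih =>
    rename_i x y z
    rw [SimpleGraph.Walk.isTrail_cons] at hw
    simp only [SimpleGraph.Walk.darts_cons, List.mem_cons] at h
    simp only [chi]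
    rcases h with h | h
    · subst h
      have : x ≠ y := h'.ne
      rw [chi_zero _ _ _ _ hw.2]
      simp [this]
    · rw [ih hw.1 h]
      have h1 : d.edge ∈ p.edges := List.mem_map_of_mem h
      have h2 : ¬ (d.edge = s(x, y)) := fun hh => hw.2 (hh ▸ h1)
      have h3 : d.edge = s(d.fst, d.snd) := rfl
      rw [h3, Sym2.eq_iff] at h2
      rw [if_neg (by tauto), if_neg (by tauto)]
      ring

lemma mem_edges_darts {G : SimpleGraph V} {u v : V} (w : G.Walk u v)
    (a b : V) (h : s(a, b) ∈ w.edges) :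
    (∃ d ∈ w.darts, d.fst = a ∧ d.snd = b) ∨ (∃ d ∈ w.darts, d.fst = b ∧ d.snd = a) := by
  obtain ⟨d, hd, he⟩ := List.mem_map.1 h
  have h3 : d.edge = s(d.fst, d.snd) := rfl
  rw [h3, Sym2.eq_iff] at he
  rcases he with he | he
  · exact Or.inl ⟨d, hd, he⟩
  · exact Or.inr ⟨d, hd, he⟩

/-- three cases for the indicator of a trail. -/
lemma chi_cases (R : Type) [CommRing R] {G : SimpleGraph V} {u v : V} (w : G.Walk u v)
    (hw : w.IsTrail) (a b : V) :
    (s(a, b) ∉ w.edges ∧ chi R w a b = 0) ∨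
    (s(a, b) ∈ w.edges ∧ chi R w a b = 1 ∧ ∃ d ∈ w.darts, d.fst = a ∧ d.snd = b) ∨
    (s(a, b) ∈ w.edges ∧ chi R w a b = -1 ∧ ∃ d ∈ w.darts, d.fst = b ∧ d.snd = a) := by
  by_cases h : s(a, b) ∈ w.edges
  · rcases mem_edges_darts w a b h with ⟨d, hd, rfl, rfl⟩ | ⟨d, hd, rfl, rfl⟩
    · exact Or.inr (Or.inl ⟨h, chi_one R w hw d hd, d, hd, rfl, rfl⟩)
    · exact Or.inr (Or.inr ⟨h, by rw [chi_antisymm, chi_one R w hw d hd], d, hd, rfl, rfl⟩)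
  · exact Or.inl ⟨h, chi_zero R w a b h⟩

/-- A path along a relation contained in adjacency. -/
lemma exists_path_of_reach {G : SimpleGraph V} (r : V → V → Prop) (hr : ∀ u v, r u v → G.Adj u v)
    {a b : V} (h : Relation.ReflTransGen r a b) :
    ∃ w : G.Walk a b, w.IsPath ∧ ∀ d ∈ w.darts, r d.fst d.snd := by
  have : ∃ w : G.Walk a b, ∀ d ∈ w.darts, r d.fst d.snd := by
    induction h using Relation.ReflTransGen.head_induction_on with
    | refl => exact ⟨.nil, by simp⟩
    | head h1 h2 ih =>
      obtain ⟨w, hw⟩ := ih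
      refine ⟨.cons (hr _ _ h1) w, ?_⟩
      intro d hd
      simp only [SimpleGraph.Walk.darts_cons, List.mem_cons] at hd
      rcases hd with rfl | hd
      · exact h1
      · exact hw d hd
  obtain ⟨w, hw⟩ := this
  exact ⟨w.bypass, w.bypass_isPath, fun d hd => hw d (w.darts_bypass_subset_darts hd)⟩

/-- Sum of divergences over a set is the flow out of it. -/
lemma sum_div {R : Type} [CommRing R] [LinearOrder R] [IsStrictOrderedRing R] [Fintype V]
    (g : V → V → R) (hg : ∀ u v, g u v = - g v u)
    (X : Finset V) : ∑ u ∈ X, ∑ v, g u v = ∑ u ∈ X, ∑ v ∈ Xᶜ, g u v := by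
  have h1 : ∑ u ∈ X, ∑ v ∈ X, g u v = 0 := by
    have h2 : ∑ u ∈ X, ∑ v ∈ X, g u v = - ∑ u ∈ X, ∑ v ∈ X, g u v := by
      conv_lhs => rw [Finset.sum_comm]
      rw [← Finset.sum_neg_distrib]
      refine Finset.sum_congr rfl fun u _ => ?_
      rw [← Finset.sum_neg_distrib]
      exact Finset.sum_congr rfl fun v _ => hg v u
    linarith
  have h3 : ∀ u, ∑ v, g u v = ∑ v ∈ X, g u v + ∑ v ∈ Xᶜ, g u v := fun u =>
    (Finset.sum_add_sum_compl X _).symm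
  simp only [h3, Finset.sum_add_distrib, h1, zero_add]

/-- total weight of walks satisfying a predicate -/
def wt {R : Type} [CommRing R] {G : SimpleGraph V} (f : (Σ u v : V, G.Walk u v) →₀ R)
    (Q : (Σ u v : V, G.Walk u v) → Prop) : R :=
  f.sum (fun p r => if Q p then r else 0)

lemma wt_add_single {R : Type} [CommRing R] {G : SimpleGraph V}
    (f : (Σ u v : V, G.Walk u v) →₀ R) (p : Σ u v : V, G.Walk u v) (ε : R)
    (Q : (Σ u v : V, G.Walk u v) → Prop) :
    wt (f + Finsupp.single p ε) Q = wt f Q + if Q p then ε else 0 := by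
  unfold wt
  rw [Finsupp.sum_add_index', Finsupp.sum_single_index]
  · simp
  · simp
  · intro a b c; split_ifs <;> simp

/-- Flow decomposition. -/
lemma flow_decomp {R : Type} [CommRing R] [LinearOrder R] [IsStrictOrderedRing R] [Fintype V]
    (G : SimpleGraph V) : ∀ (n : ℕ) (g : V → V → R),
    (∀ u v, g u v = - g v u) → (∀ u v, 0 < g u v → G.Adj u v) →
    (Finset.univ.filter (fun x : V × V => g x.1 x.2 ≠ 0)).card +
      (Finset.univ.filter (fun x : V => ∑ v, g x v ≠ 0)).card = n →
    ∃ f : (Σ u v : V, G.Walk u v) →₀ R, (∀ p, 0 ≤ f p) ∧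
      (∀ p ∈ f.support, p.2.2.IsPath ∧ 0 < ∑ v, g p.1 v ∧ ∑ v, g p.2.1 v < 0) ∧
      (∀ a, 0 ≤ ∑ v, g a v → wt f (fun p => p.1 = a) = ∑ v, g a v) ∧
      (∀ b, ∑ v, g b v ≤ 0 → wt f (fun p => p.2.1 = b) = - ∑ v, g b v) ∧
      (∀ u v, wt f (fun p => s(u, v) ∈ p.2.2.edges) ≤ |g u v|) := by
  intro n
  induction n using Nat.strong_induction_on with
  | _ n ih =>
  intro g hg hadj hn
  by_cases hz : ∀ a, ∑ v, g a v ≤ 0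
  · have hz' : ∀ a, ∑ v, g a v = 0 := by
      have h0 : ∑ a, ∑ v, g a v = 0 := by
        have := sum_div g hg Finset.univ
        simpa using this
      have := (Finset.sum_eq_zero_iff_of_nonpos (fun i _ => hz i)).1 h0
      exact fun a => this a (Finset.mem_univ a)
    refine ⟨0, by simp, by simp, ?_, ?_, ?_⟩
    · intro a _; simp [wt, hz']
    · intro a _; simp [wt, hz']
    · intro u v; simp [wt]
  push Not at hz
  obtain ⟨a, ha⟩ := hz
  -- reachable set
  set r : V → V → Prop := fun u v => 0 < g u v with hr
  have hb : ∃ b, Relation.ReflTransGen r a b ∧ ∑ v, g b v < 0 := by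
    by_contra hcon
    push Not at hcon
    set X : Finset V := Finset.univ.filter (fun b => Relation.ReflTransGen r a b) with hX
    have h1 := sum_div g hg X
    have h2 : ∑ u ∈ X, ∑ v ∈ Xᶜ, g u v ≤ 0 := by
      refine Finset.sum_nonpos fun u hu => Finset.sum_nonpos fun v hv => ?_
      by_contra hlt
      push Not at hlt
      simp only [hX, Finset.mem_compl, Finset.mem_filter, Finset.mem_univ, true_and] at hu hv
      exact hv (hu.tail hlt)
    have h3 : ∑ v, g a v ≤ ∑ u ∈ X, ∑ v, g u v := by
      refine Finset.single_le_sum (f := fun u => ∑ v, g u v) ?_ ?_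
      · intro i hi
        simp only [hX, Finset.mem_filter, Finset.mem_univ, true_and] at hi
        exact hcon i hi
      · simp only [hX, Finset.mem_filter, Finset.mem_univ, true_and]
        exact .refl
    linarith
  obtain ⟨b, hab, hb⟩ := hb
  obtain ⟨w, hw, hwd⟩ := exists_path_of_reach (G := G) r hadj hab
  have hne : a ≠ b := by rintro rfl; linarith
  set S : Finset R := insert (∑ v, g a v) (insert (-∑ v, g b v)
    (w.darts.toFinset.image (fun d => g d.fst d.snd))) with hS
  have hSne : S.Nonempty := ⟨_, Finset.mem_insert_self _ _⟩
  obtain ⟨ε, hεS, hεmin⟩ := S.exists_min_image id hSne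
  have hεpos : 0 < ε := by
    simp only [hS, Finset.mem_insert, Finset.mem_image, List.mem_toFinset] at hεS
    rcases hεS with h | h | ⟨d, hd, h⟩
    · linarith
    · linarith
    · rw [← h]; exact hwd d hd
  have hεa : ε ≤ ∑ v, g a v := hεmin _ (by simp [hS])
  have hεb : ε ≤ -∑ v, g b v := hεmin _ (by simp [hS])
  have hεd : ∀ d ∈ w.darts, ε ≤ g d.fst d.snd := fun d hd => hεmin _ (by
    simp only [hS, Finset.mem_insert, Finset.mem_image, List.mem_toFinset]
    exact Or.inr (Or.inr ⟨d, hd, rfl⟩))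
  set g' : V → V → R := fun u v => g u v - ε * chi R w u v with hg'
  have hdiv : ∀ x, ∑ v, g' x v = ∑ v, g x v
      - ε * ((if x = a then 1 else 0) - (if x = b then 1 else 0)) := by
    intro x
    simp only [hg', Finset.sum_sub_distrib, ← Finset.mul_sum, chi_div]
  have hda : ∑ v, g' a v = ∑ v, g a v - ε := by rw [hdiv]; simp [hne]
  have hdb : ∑ v, g' b v = ∑ v, g b v + ε := by rw [hdiv]; simp [hne.symm]
  have hdo : ∀ x, x ≠ a → x ≠ b → ∑ v, g' x v = ∑ v, g x v := by
    intro x h1 h2; rw [hdiv]; simp [h1, h2]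
  have hanti : ∀ u v, g' u v = - g' v u := by
    intro u v; simp only [hg']; rw [hg u v, chi_antisymm R w u v]; ring
  -- three cases for the new flow
  have hcs : ∀ u v, (s(u,v) ∉ w.edges ∧ g' u v = g u v) ∨
      (s(u,v) ∈ w.edges ∧ g' u v = g u v - ε ∧ ε ≤ g u v) ∨
      (s(u,v) ∈ w.edges ∧ g' u v = g u v + ε ∧ g u v ≤ -ε) := by
    intro u v
    rcases chi_cases R w hw.isTrail u v with ⟨h, h'⟩ | ⟨h, h', d, hd, rfl, rfl⟩ |
      ⟨h, h', d, hd, rfl, rfl⟩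
    · left; exact ⟨h, by simp [hg', h']⟩
    · right; left; exact ⟨h, by simp [hg', h'], hεd d hd⟩
    · right; right
      refine ⟨h, by simp [hg', h'], ?_⟩
      have := hεd d hd
      rw [hg] at this; linarith
  have hadj' : ∀ u v, 0 < g' u v → G.Adj u v := by
    intro u v h
    apply hadj
    rcases hcs u v with h1 | h1 | h1
    · rw [← h1.2]; exact h
    · linarith [h1.2.2]
    · linarith [h1.2.1, h1.2.2]
  have hsub1 : (Finset.univ.filter (fun x : V × V => g' x.1 x.2 ≠ 0)) ⊆
      (Finset.univ.filter (fun x : V × V => g x.1 x.2 ≠ 0)) := by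
    intro x
    simp only [Finset.mem_filter, Finset.mem_univ, true_and]
    intro h h0
    rcases hcs x.1 x.2 with h1 | h1 | h1
    · exact h (h1.2.trans h0)
    · linarith [h1.2.2]
    · linarith [h1.2.2]
  have hsub2 : (Finset.univ.filter (fun x : V => ∑ v, g' x v ≠ 0)) ⊆
      (Finset.univ.filter (fun x : V => ∑ v, g x v ≠ 0)) := by
    intro x
    simp only [Finset.mem_filter, Finset.mem_univ, true_and]
    intro h h0
    by_cases h1 : x = a
    · subst h1; linarith
    by_cases h2 : x = b
    · subst h2; linarith
    exact h ((hdo x h1 h2).trans h0)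
  have hlt : (Finset.univ.filter (fun x : V × V => g' x.1 x.2 ≠ 0)).card +
      (Finset.univ.filter (fun x : V => ∑ v, g' x v ≠ 0)).card < n := by
    rw [← hn]
    simp only [hS, Finset.mem_insert, Finset.mem_image, List.mem_toFinset] at hεS
    rcases hεS with h | h | ⟨d, hd, h⟩
    · refine add_lt_add_of_le_of_lt (Finset.card_le_card hsub1) (Finset.card_lt_card ?_)
      refine (Finset.ssubset_iff_of_subset hsub2).2 ⟨a, ?_, ?_⟩
      · simp [ha.ne']
      · simp only [Finset.mem_filter, Finset.mem_univ, true_and, not_not]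
        rw [hda, h]; ring
    · refine add_lt_add_of_le_of_lt (Finset.card_le_card hsub1) (Finset.card_lt_card ?_)
      refine (Finset.ssubset_iff_of_subset hsub2).2 ⟨b, ?_, ?_⟩
      · simp [hb.ne]
      · simp only [Finset.mem_filter, Finset.mem_univ, true_and, not_not]
        rw [hdb, h]; ring
    · refine add_lt_add_of_lt_of_le (Finset.card_lt_card ?_) (Finset.card_le_card hsub2)
      refine (Finset.ssubset_iff_of_subset hsub1).2 ⟨(d.fst, d.snd), ?_, ?_⟩
      · have := hwd d hd
        simp only [Finset.mem_filter, Finset.mem_univ, true_and]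
        exact this.ne'
      · simp only [Finset.mem_filter, Finset.mem_univ, true_and, not_not]
        simp only [hg', chi_one R w hw.isTrail d hd, h]; ring
  obtain ⟨f, hf0, hfp, hfa, hfb, hfe⟩ := ih _ hlt g' hanti hadj' rfl
  have hpos' : ∀ x, 0 < ∑ v, g' x v → 0 < ∑ v, g x v := by
    intro x h
    by_cases h1 : x = a
    · rw [h1]; exact ha
    by_cases h2 : x = b
    · subst h2; linarith
    rwa [← hdo x h1 h2]
  have hneg' : ∀ x, ∑ v, g' x v < 0 → ∑ v, g x v < 0 := by
    intro x h
    by_cases h1 : x = a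
    · subst h1; linarith
    by_cases h2 : x = b
    · rw [h2]; exact hb
    rwa [← hdo x h1 h2]
  refine ⟨f + Finsupp.single ⟨a, b, w⟩ ε, ?_, ?_, ?_, ?_, ?_⟩
  · intro p
    rw [Finsupp.add_apply, Finsupp.single_apply]
    have := hf0 p
    split_ifs <;> linarith
  · intro p hp
    have := Finsupp.support_add hp
    rw [Finset.mem_union] at this
    rcases this with h | h
    · obtain ⟨h1, h2, h3⟩ := hfp p h
      exact ⟨h1, hpos' _ h2, hneg' _ h3⟩
    · have := Finsupp.support_single_subset h
      rw [Finset.mem_singleton] at this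
      subst this
      exact ⟨hw, ha, hb⟩
  · intro x hx
    rw [wt_add_single]
    by_cases h1 : x = a
    · subst h1
      rw [hfa _ (by linarith)]; simp [hda]
    · have h2 : x ≠ b := by rintro rfl; linarith
      rw [if_neg (fun h => h1 h.symm), hfa x (by rw [hdo x h1 h2]; exact hx), hdo x h1 h2]
      simp
  · intro x hx
    rw [wt_add_single]
    by_cases h1 : x = b
    · subst h1
      rw [hfb _ (by linarith)]; simp [hdb]
    · have h2 : x ≠ a := by rintro rfl; linarith
      rw [if_neg (fun h => h1 h.symm), hfb x (by rw [hdo x h2 h1]; exact hx), hdo x h2 h1]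
      simp
  · intro u v
    rw [wt_add_single]
    have := hfe u v
    rcases hcs u v with ⟨h1, h2⟩ | ⟨h1, h2, h3⟩ | ⟨h1, h2, h3⟩
    · rw [if_neg h1, ← h2]; linarith
    · rw [if_pos h1]
      rw [abs_of_nonneg (by linarith)] at this ⊢
      linarith
    · rw [if_pos h1]
      rw [abs_of_nonpos (by linarith)] at this ⊢
      linarith

/-- Edge flows from `A` to `B` with edge capacity `η` and vertex bounds `κ`. -/
structure IsFlow {R : Type} [CommRing R] [LinearOrder R] [Fintype V]
    (G : SimpleGraph V) (η κ : R) (A B : Finset V) (g : V → V → R) : Prop where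
  anti : ∀ u v, g u v = - g v u
  cap : ∀ u v, g u v ≤ if G.Adj u v then η else 0
  srcLe : ∀ a ∈ A, ∑ v, g a v ≤ κ
  srcGe : ∀ a ∈ A, 0 ≤ ∑ v, g a v
  snkLe : ∀ b ∈ B, ∑ v, g b v ≤ 0
  snkGe : ∀ b ∈ B, -κ ≤ ∑ v, g b v
  cons : ∀ x, x ∉ A → x ∉ B → ∑ v, g x v = 0

lemma sum_cap {R : Type} [CommRing R] [Fintype V]
    (G : SimpleGraph V) (η : R) (X : Finset V) :
    ∑ u ∈ X, ∑ v ∈ Xᶜ, (if G.Adj u v then η else 0) = η * (cutCard G X Xᶜ : R) := by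
  rw [← Finset.sum_product', ← Finset.sum_filter, Finset.sum_const, cutCard, nsmul_eq_mul,
    mul_comm]

lemma exists_pos_le {R ι : Type} [CommRing R] [LinearOrder R] [IsStrictOrderedRing R]
    (s : Finset ι) (h : ι → R) (hh : ∀ i ∈ s, 0 < h i) : ∃ ε > 0, ∀ i ∈ s, ε ≤ h i := by
  induction s using Finset.induction_on with
  | empty => exact ⟨1, one_pos, by simp⟩
  | insert i s _ ih =>
    obtain ⟨ε, h1, h2⟩ := ih (fun j hj => hh j (Finset.mem_insert_of_mem hj))
    refine ⟨min ε (h i), lt_min h1 (hh i (Finset.mem_insert_self _ _)), ?_⟩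
    intro j hj
    rcases Finset.mem_insert.1 hj with rfl | hj
    · exact min_le_right _ _
    · exact (min_le_left _ _).trans (h2 j hj)

/-- A flow of maximum value attains the minimum cut. -/
lemma max_flow_ge {R : Type} [CommRing R] [LinearOrder R] [IsStrictOrderedRing R] [Fintype V]
    (G : SimpleGraph V) (η κ K : R) (A B : Finset V) (hAB : Disjoint A B) (g : V → V → R)
    (hg : IsFlow G η κ A B g)
    (hmax : ∀ g', IsFlow G η κ A B g' → ∑ a ∈ A, ∑ v, g' a v ≤ ∑ a ∈ A, ∑ v, g a v)
    (hcut : ∀ X : Finset V, K ≤ κ * ((A \ X).card : R) + κ * ((B ∩ X).card : R)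
      + η * (cutCard G X Xᶜ : R)) :
    K ≤ ∑ a ∈ A, ∑ v, g a v := by
  set c : V → V → R := fun u v => if G.Adj u v then η else 0 with hc
  set r : V → V → Prop := fun u v => g u v < c u v with hr
  have hradj : ∀ u v, r u v → G.Adj u v := by
    intro u v h
    by_contra hn
    have h1 := hg.cap v u
    rw [if_neg (fun h => hn h.symm)] at h1
    have h2 : g u v < 0 := by
      have := h
      simp only [hr, hc, if_neg hn] at this
      exact this
    have h3 := hg.anti u v
    linarith
  set X : Finset V := Finset.univ.filter
    (fun x => ∃ a ∈ A, ∑ v, g a v < κ ∧ Relation.ReflTransGen r a x) with hX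
  have hmemX : ∀ x, x ∈ X ↔ ∃ a ∈ A, ∑ v, g a v < κ ∧ Relation.ReflTransGen r a x := by
    intro x; simp [hX]
  -- no augmenting path
  have hno : ∀ b ∈ B, b ∈ X → ∑ v, g b v = -κ := by
    intro b hb hbX
    by_contra hne
    have hblt : -κ < ∑ v, g b v := lt_of_le_of_ne (hg.snkGe b hb) (Ne.symm hne)
    obtain ⟨a, haA, halt, hreach⟩ := (hmemX b).1 hbX
    have hab : a ≠ b := fun h => Finset.disjoint_left.1 hAB haA (h ▸ hb)
    obtain ⟨w, hw, hwd⟩ := exists_path_of_reach (G := G) r hradj hreach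
    obtain ⟨ε0, hε0, hε0d⟩ := exists_pos_le w.darts.toFinset
      (fun d => c d.fst d.snd - g d.fst d.snd)
      (fun d hd => sub_pos.2 (hwd d (List.mem_toFinset.1 hd)))
    set ε := min ε0 (min (κ - ∑ v, g a v) (κ + ∑ v, g b v)) with hε
    have hεpos : 0 < ε := lt_min hε0 (lt_min (by linarith) (by linarith))
    have hεa : ε ≤ κ - ∑ v, g a v := (min_le_right _ _).trans (min_le_left _ _)
    have hεb : ε ≤ κ + ∑ v, g b v := (min_le_right _ _).trans (min_le_right _ _)
    have hεd : ∀ d ∈ w.darts, ε ≤ c d.fst d.snd - g d.fst d.snd := fun d hd =>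
      (min_le_left _ _).trans (hε0d d (List.mem_toFinset.2 hd))
    set g' : V → V → R := fun u v => g u v + ε * chi R w u v with hg'
    have hdiv : ∀ x, ∑ v, g' x v = ∑ v, g x v
        + ε * ((if x = a then 1 else 0) - (if x = b then 1 else 0)) := by
      intro x
      simp only [hg', Finset.sum_add_distrib, ← Finset.mul_sum, chi_div]
    have hda : ∑ v, g' a v = ∑ v, g a v + ε := by rw [hdiv]; simp [hab]
    have hdb : ∑ v, g' b v = ∑ v, g b v - ε := by rw [hdiv]; simp [hab.symm]; ring
    have hdo : ∀ x, x ≠ a → x ≠ b → ∑ v, g' x v = ∑ v, g x v := by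
      intro x h1 h2; rw [hdiv]; simp [h1, h2]
    have hfl : IsFlow G η κ A B g' := by
      refine ⟨?_, ?_, ?_, ?_, ?_, ?_, ?_⟩
      · intro u v; simp only [hg']; rw [hg.anti u v, chi_antisymm R w u v]; ring
      · intro u v
        change g' u v ≤ c u v
        have hcap : g u v ≤ c u v := hg.cap u v
        rcases chi_cases R w hw.isTrail u v with ⟨h, h'⟩ | ⟨h, h', d, hd, rfl, rfl⟩ |
          ⟨h, h', d, hd, rfl, rfl⟩
        · simp only [hg', h']; linarith
        · simp only [hg', h']; linarith [hεd d hd]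
        · simp only [hg', h']; linarith
      · intro x hx
        have hxb : x ≠ b := fun h => Finset.disjoint_left.1 hAB hx (h ▸ hb)
        by_cases h1 : x = a
        · subst h1; linarith
        · rw [hdo x h1 hxb]; exact hg.srcLe x hx
      · intro x hx
        have hxb : x ≠ b := fun h => Finset.disjoint_left.1 hAB hx (h ▸ hb)
        by_cases h1 : x = a
        · subst h1; linarith [hg.srcGe x hx]
        · rw [hdo x h1 hxb]; exact hg.srcGe x hx
      · intro x hx
        have hxa : x ≠ a := fun h => Finset.disjoint_left.1 hAB (h ▸ haA) hx
        by_cases h1 : x = b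
        · subst h1; linarith [hg.snkLe x hx]
        · rw [hdo x hxa h1]; exact hg.snkLe x hx
      · intro x hx
        have hxa : x ≠ a := fun h => Finset.disjoint_left.1 hAB (h ▸ haA) hx
        by_cases h1 : x = b
        · subst h1; linarith
        · rw [hdo x hxa h1]; exact hg.snkGe x hx
      · intro x h1 h2
        rw [hdo x (fun h => h1 (h ▸ haA)) (fun h => h2 (h ▸ hb))]
        exact hg.cons x h1 h2
    have h1 := hmax g' hfl
    have h2 : ∑ x ∈ A, ∑ v, g x v < ∑ x ∈ A, ∑ v, g' x v := by
      refine Finset.sum_lt_sum (fun x hx => ?_) ⟨a, haA, by linarith⟩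
      have hxb : x ≠ b := fun h => Finset.disjoint_left.1 hAB hx (h ▸ hb)
      by_cases h1 : x = a
      · subst h1; linarith
      · rw [hdo x h1 hxb]
    linarith
  have hout : ∑ u ∈ X, ∑ v ∈ Xᶜ, g u v = η * (cutCard G X Xᶜ : R) := by
    rw [← sum_cap]
    refine Finset.sum_congr rfl fun u hu => Finset.sum_congr rfl fun v hv => ?_
    refine le_antisymm (hg.cap u v) ?_
    by_contra hlt
    push Not at hlt
    rw [Finset.mem_compl] at hv
    obtain ⟨a, haA, halt, hreach⟩ := (hmemX u).1 hu
    exact hv ((hmemX v).2 ⟨a, haA, halt, hreach.tail hlt⟩)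
  have hsX : ∑ u ∈ X, ∑ v, g u v = ∑ u ∈ A ∩ X, ∑ v, g u v + ∑ u ∈ B ∩ X, ∑ v, g u v := by
    rw [← Finset.sum_union]
    · symm
      refine Finset.sum_subset ?_ ?_
      · intro x; simp only [Finset.mem_union, Finset.mem_inter]; tauto
      · intro x hx hn
        simp only [Finset.mem_union, Finset.mem_inter] at hn
        exact hg.cons x (by tauto) (by tauto)
    · exact hAB.mono Finset.inter_subset_left Finset.inter_subset_left
  have hBX : ∑ u ∈ B ∩ X, ∑ v, g u v = -(κ * ((B ∩ X).card : R)) := by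
    rw [Finset.sum_congr rfl (g := fun _ => -κ)]
    · simp [mul_comm]
    · intro x hx
      rw [Finset.mem_inter] at hx
      exact hno x hx.1 hx.2
  have hAX : ∑ u ∈ A \ X, ∑ v, g u v = κ * ((A \ X).card : R) := by
    rw [Finset.sum_congr rfl (g := fun _ => κ)]
    · simp [mul_comm]
    · intro x hx
      rw [Finset.mem_sdiff] at hx
      refine le_antisymm (hg.srcLe x hx.1) ?_
      by_contra hlt
      push Not at hlt
      exact hx.2 ((hmemX x).2 ⟨x, hx.1, hlt, .refl⟩)
  have hAs : ∑ u ∈ A, ∑ v, g u v = ∑ u ∈ A ∩ X, ∑ v, g u v + ∑ u ∈ A \ X, ∑ v, g u v :=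
    (Finset.sum_inter_add_sum_sdiff A X _).symm
  have hdivX := sum_div g hg.anti X
  have := hcut X
  linarith

lemma zero_isFlow {R : Type} [CommRing R] [LinearOrder R] [IsStrictOrderedRing R] [Fintype V]
    (G : SimpleGraph V) (η κ : R) (hη : 0 ≤ η) (hκ : 0 ≤ κ) (A B : Finset V) :
    IsFlow G η κ A B (fun _ _ => 0) := by
  refine ⟨?_, ?_, ?_, ?_, ?_, ?_, ?_⟩
  · simp
  · intro u v; split_ifs <;> simp [hη]
  all_goals simp [hκ]

lemma exists_max_real [Fintype V] (G : SimpleGraph V) (η κ : ℝ) (hη : 0 ≤ η) (hκ : 0 ≤ κ)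
    (A B : Finset V) : ∃ g, IsFlow G η κ A B g ∧
    ∀ g', IsFlow G η κ A B g' → ∑ a ∈ A, ∑ v, g' a v ≤ ∑ a ∈ A, ∑ v, g a v := by
  have hset : {g : V → V → ℝ | IsFlow G η κ A B g} =
      {g | ∀ u v, g u v = - g v u} ∩ {g | ∀ u v, g u v ≤ if G.Adj u v then η else 0} ∩
      {g | ∀ a ∈ A, ∑ v, g a v ≤ κ} ∩ {g | ∀ a ∈ A, 0 ≤ ∑ v, g a v} ∩
      {g | ∀ b ∈ B, ∑ v, g b v ≤ 0} ∩ {g | ∀ b ∈ B, -κ ≤ ∑ v, g b v} ∩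
      {g | ∀ x, x ∉ A → x ∉ B → ∑ v, g x v = 0} := by
    ext g
    simp only [Set.mem_ofPred_eq, Set.mem_inter_iff]
    constructor
    · rintro ⟨h1, h2, h3, h4, h5, h6, h7⟩
      exact ⟨⟨⟨⟨⟨⟨h1, h2⟩, h3⟩, h4⟩, h5⟩, h6⟩, h7⟩
    · rintro ⟨⟨⟨⟨⟨⟨h1, h2⟩, h3⟩, h4⟩, h5⟩, h6⟩, h7⟩
      exact ⟨h1, h2, h3, h4, h5, h6, h7⟩
  have hclosed : IsClosed {g : V → V → ℝ | IsFlow G η κ A B g} := by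
    rw [hset]
    refine (((((IsClosed.inter ?_ ?_).inter ?_).inter ?_).inter ?_).inter ?_).inter ?_
    · simp only [Set.ofPred_forall]
      exact isClosed_iInter fun u => isClosed_iInter fun v =>
        isClosed_eq (by fun_prop) (by fun_prop)
    · simp only [Set.ofPred_forall]
      exact isClosed_iInter fun u => isClosed_iInter fun v =>
        isClosed_le (by fun_prop) continuous_const
    · simp only [Set.ofPred_forall]
      exact isClosed_iInter fun u => isClosed_iInter fun v =>
        isClosed_le (by fun_prop) (by fun_prop)
    · simp only [Set.ofPred_forall]
      exact isClosed_iInter fun u => isClosed_iInter fun v =>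
        isClosed_le (by fun_prop) (by fun_prop)
    · simp only [Set.ofPred_forall]
      exact isClosed_iInter fun u => isClosed_iInter fun v =>
        isClosed_le (by fun_prop) (by fun_prop)
    · simp only [Set.ofPred_forall]
      exact isClosed_iInter fun u => isClosed_iInter fun v =>
        isClosed_le (by fun_prop) (by fun_prop)
    · simp only [Set.ofPred_forall]
      exact isClosed_iInter fun u => isClosed_iInter fun v => isClosed_iInter fun w =>
        isClosed_eq (by fun_prop) (by fun_prop)
  have hcomp : IsCompact {g : V → V → ℝ | IsFlow G η κ A B g} := by
    refine IsCompact.of_isClosed_subset (isCompact_Icc (a := fun _ _ => -η) (b := fun _ _ => η))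
      hclosed ?_
    intro g hg
    have h1 : ∀ u v, g u v ≤ η := fun u v => (hg.cap u v).trans (by split_ifs <;> simp [hη])
    refine ⟨fun u v => ?_, fun u v => h1 u v⟩
    have := h1 v u
    have h2 := hg.anti u v
    change -η ≤ g u v
    linarith
  obtain ⟨g, hg, hmax⟩ := hcomp.exists_isMaxOn ⟨_, zero_isFlow G η κ hη hκ A B⟩
    (f := fun g => ∑ a ∈ A, ∑ v, g a v) (by fun_prop)
  exact ⟨g, hg, fun g' hg' => hmax hg'⟩

lemma exists_max_int [Fintype V] (G : SimpleGraph V) (η κ : ℤ) (hη : 0 ≤ η) (hκ : 0 ≤ κ)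
    (A B : Finset V) : ∃ g, IsFlow G η κ A B g ∧
    ∀ g', IsFlow G η κ A B g' → ∑ a ∈ A, ∑ v, g' a v ≤ ∑ a ∈ A, ∑ v, g a v := by
  obtain ⟨m, ⟨g, hg, hm⟩, hmax⟩ := Int.exists_greatest_of_bdd
    (P := fun z => ∃ g : V → V → ℤ, IsFlow G η κ A B g ∧ ∑ a ∈ A, ∑ v, g a v = z)
    ⟨A.card * κ, by
      rintro z ⟨g, hg, rfl⟩
      calc _ ≤ ∑ a ∈ A, κ := Finset.sum_le_sum hg.srcLe
        _ = _ := by simp⟩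
    ⟨_, _, zero_isFlow G η κ hη hκ A B, rfl⟩
  exact ⟨g, hg, fun g' hg' => by rw [hm]; exact hmax _ ⟨g', hg', rfl⟩⟩

lemma IsFlow.abs_le {R : Type} [CommRing R] [LinearOrder R] [IsStrictOrderedRing R] [Fintype V]
    {G : SimpleGraph V} {η κ : R} (hη : 0 ≤ η) {A B : Finset V} {g : V → V → R}
    (hg : IsFlow G η κ A B g) (u v : V) : |g u v| ≤ η := by
  have h1 : ∀ u v, g u v ≤ η := fun u v => (hg.cap u v).trans (by split_ifs <;> simp [hη])
  rw [_root_.abs_le]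
  have := h1 v u
  have h2 := hg.anti u v
  exact ⟨by linarith, h1 u v⟩

lemma IsFlow.adj {R : Type} [CommRing R] [LinearOrder R] [IsStrictOrderedRing R] [Fintype V]
    {G : SimpleGraph V} {η κ : R} {A B : Finset V} {g : V → V → R}
    (hg : IsFlow G η κ A B g) (u v : V) (h : 0 < g u v) : G.Adj u v := by
  by_contra hn
  have := hg.cap u v
  rw [if_neg hn] at this
  linarith

lemma IsFlow.mem_src {R : Type} [CommRing R] [LinearOrder R] [IsStrictOrderedRing R] [Fintype V]
    {G : SimpleGraph V} {η κ : R} {A B : Finset V} {g : V → V → R}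
    (hg : IsFlow G η κ A B g) (u : V) (h : 0 < ∑ v, g u v) : u ∈ A := by
  by_contra hn
  by_cases hB : u ∈ B
  · linarith [hg.snkLe u hB]
  · linarith [hg.cons u hn hB]

lemma IsFlow.mem_snk {R : Type} [CommRing R] [LinearOrder R] [IsStrictOrderedRing R] [Fintype V]
    {G : SimpleGraph V} {η κ : R} {A B : Finset V} {g : V → V → R}
    (hg : IsFlow G η κ A B g) (u : V) (h : ∑ v, g u v < 0) : u ∈ B := by
  by_contra hn
  by_cases hA : u ∈ A
  · linarith [hg.srcGe u hA]
  · linarith [hg.cons u hA hn]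

lemma wt_eq {R : Type} [CommRing R] {G : SimpleGraph V} (f : (Σ u v : V, G.Walk u v) →₀ R)
    (Q : (Σ u v : V, G.Walk u v) → Prop) [inst : DecidablePred Q] :
    wt f Q = ∑ p ∈ f.support.filter Q, f p := by
  rw [wt, Finsupp.sum, Finset.sum_filter]
  refine Finset.sum_congr rfl fun p _ => ?_
  congr

lemma flow_of_cut [Fintype V] (G : SimpleGraph V) (η : ℝ) (hη : 0 ≤ η)
    (A B : Finset V) (hAB : Disjoint A B) (hcard : A.card = B.card)
    (hcut : ∀ X : Finset V, ((A ∩ X).card : ℝ) ≤ (B ∩ X).card + η * cutCard G X Xᶜ) :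
    HasUnitFlowIn G Finset.univ A B η := by
  obtain ⟨g, hg, hmax⟩ := exists_max_real G η 1 hη zero_le_one A B
  have hval := max_flow_ge G η 1 (A.card : ℝ) A B hAB g hg hmax (by
    intro X
    have h1 := hcut X
    have h2 : (A ∩ X).card + (A \ X).card = A.card := Finset.card_inter_add_card_sdiff A X
    have h3 : ((A ∩ X).card : ℝ) + (A \ X).card = A.card := by exact_mod_cast h2
    linarith)
  have hA : ∀ a ∈ A, ∑ v, g a v = 1 := by
    have h1 : ∑ a ∈ A, ∑ v, g a v = ∑ a ∈ A, (1:ℝ) :=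
      le_antisymm (Finset.sum_le_sum hg.srcLe) (by simpa using hval)
    exact (Finset.sum_eq_sum_iff_of_le hg.srcLe).1 h1
  have hB : ∀ b ∈ B, ∑ v, g b v = -1 := by
    have h0 : ∑ x, ∑ v, g x v = 0 := by
      have := sum_div g hg.anti Finset.univ
      simpa using this
    have h1 : ∑ x, ∑ v, g x v = ∑ x ∈ A, ∑ v, g x v + ∑ x ∈ B, ∑ v, g x v := by
      rw [← Finset.sum_union hAB]
      symm
      refine Finset.sum_subset (Finset.subset_univ _) ?_
      intro x _ hx
      rw [Finset.mem_union, not_or] at hx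
      exact hg.cons x hx.1 hx.2
    have h2 : ∑ a ∈ A, ∑ v, g a v = (A.card : ℝ) := by
      rw [Finset.sum_congr rfl hA]; simp
    have h3 : ∑ b ∈ B, (-1:ℝ) = ∑ b ∈ B, ∑ v, g b v := by
      rw [Finset.sum_const, ← hcard, nsmul_eq_mul]; linarith
    intro b hb
    exact ((Finset.sum_eq_sum_iff_of_le hg.snkGe).1 h3 b hb).symm
  obtain ⟨f, hf0, hfp, hfa, hfb, hfe⟩ := flow_decomp G _ g hg.anti hg.adj rfl
  refine ⟨f.support, f, fun p _ => hf0 p, ?_, by simp, ?_, ?_, ?_⟩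
  · intro p hp
    obtain ⟨_, h2, h3⟩ := hfp p hp
    exact ⟨hg.mem_src _ h2, hg.mem_snk _ h3⟩
  · intro a ha
    rw [← wt_eq, hfa a (hg.srcGe a ha), hA a ha]
  · intro b hb
    rw [← wt_eq, hfb b (hg.snkLe b hb), hB b hb]; norm_num
  · intro e
    rw [← wt_eq]
    induction e using Sym2.ind with
    | _ u v => exact (hfe u v).trans (hg.abs_le hη u v)

lemma menger [Fintype V] (G : SimpleGraph V) (A B : Finset V) (hAB : Disjoint A B) (k : ℕ)
    (hcut : ∀ X : Finset V, A ⊆ X → Disjoint B X → k ≤ cutCard G X Xᶜ) :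
    ∃ P : Finset (Σ u v : V, G.Walk u v),
      P.card = k ∧
      (∀ q ∈ P, q.2.2.IsPath ∧ q.1 ∈ A ∧ q.2.1 ∈ B) ∧
      (∀ q ∈ P, ∀ r ∈ P, q ≠ r → ∀ e ∈ q.2.2.edges, e ∉ r.2.2.edges) := by
  obtain ⟨g, hg, hmax⟩ := exists_max_int G 1 (k : ℤ) zero_le_one (by positivity) A B
  have hval := max_flow_ge G 1 (k : ℤ) (k : ℤ) A B hAB g hg hmax (by
    intro X
    by_cases h1 : A ⊆ X
    · by_cases h2 : Disjoint B X
      · have : (k : ℤ) ≤ cutCard G X Xᶜ := by exact_mod_cast hcut X h1 h2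
        have h3 : (0:ℤ) ≤ (k : ℤ) * ((A \ X).card : ℤ) := by positivity
        have h4 : (0:ℤ) ≤ (k : ℤ) * ((B ∩ X).card : ℤ) := by positivity
        push_cast at *
        linarith
      · have h5 : 0 < (B ∩ X).card := by
          rw [Finset.card_pos, Finset.nonempty_iff_ne_empty]
          intro h; exact h2 (Finset.disjoint_iff_inter_eq_empty.2 h)
        have h3 : (0:ℤ) ≤ (k : ℤ) * ((A \ X).card : ℤ) := by positivity
        have h6 : (1:ℤ) ≤ (B ∩ X).card := by exact_mod_cast h5
        have h4 : (0:ℤ) ≤ cutCard G X Xᶜ := by positivity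
        have h7 : (0:ℤ) ≤ k := by positivity
        have := mul_le_mul_of_nonneg_left h6 h7
        push_cast at *
        linarith
    · have h5 : 0 < (A \ X).card := by
        rw [Finset.card_pos, Finset.sdiff_nonempty]; exact h1
      have h3 : (0:ℤ) ≤ (k : ℤ) * ((B ∩ X).card : ℤ) := by positivity
      have h6 : (1:ℤ) ≤ (A \ X).card := by exact_mod_cast h5
      have h4 : (0:ℤ) ≤ cutCard G X Xᶜ := by positivity
      have h7 : (0:ℤ) ≤ k := by positivity
      have := mul_le_mul_of_nonneg_left h6 h7
      push_cast at *
      linarith)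
  obtain ⟨f, hf0, hfp, hfa, hfb, hfe⟩ := flow_decomp G _ g hg.anti hg.adj rfl
  have hmem : ∀ p ∈ f.support, p.2.2.IsPath ∧ p.1 ∈ A ∧ p.2.1 ∈ B := by
    intro p hp
    obtain ⟨h1, h2, h3⟩ := hfp p hp
    exact ⟨h1, hg.mem_src _ h2, hg.mem_snk _ h3⟩
  have hf1 : ∀ p ∈ f.support, 1 ≤ f p := by
    intro p hp
    have h1 := hf0 p
    have h2 := Finsupp.mem_support_iff.1 hp
    omega
  have hedge : ∀ e : Sym2 V, ∑ p ∈ f.support.filter (fun p => e ∈ p.2.2.edges), f p ≤ 1 := by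
    intro e
    rw [← wt_eq]
    induction e using Sym2.ind with
    | _ u v => exact (hfe u v).trans (hg.abs_le zero_le_one u v)
  have hle1 : ∀ p ∈ f.support, f p ≤ 1 := by
    intro p hp
    obtain ⟨_, h2, h3⟩ := hmem p hp
    have hne : p.2.2.edges ≠ [] := by
      obtain ⟨u, v, w⟩ := p
      cases w with
      | nil => exact absurd h3 (Finset.disjoint_left.1 hAB h2)
      | cons h q => simp
    obtain ⟨e, he⟩ := List.exists_mem_of_ne_nil _ hne
    refine le_trans ?_ (hedge e)
    exact Finset.single_le_sum (f := fun p => f p) (fun i _ => hf0 i)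
      (Finset.mem_filter.2 ⟨hp, he⟩)
  have htot : ∑ a ∈ A, ∑ v, g a v = ∑ p ∈ f.support, f p := by
    rw [← Finset.sum_fiberwise_of_maps_to (s := f.support) (t := A) (g := fun p => p.1)
      (fun p hp => (hmem p hp).2.1)]
    refine Finset.sum_congr rfl fun a ha => ?_
    rw [← wt_eq, hfa a (hg.srcGe a ha)]
  have hk : k ≤ f.support.card := by
    have h1 : ∑ p ∈ f.support, f p ≤ ∑ p ∈ f.support, (1:ℤ) := Finset.sum_le_sum hle1
    simp only [Finset.sum_const, nsmul_eq_mul, mul_one] at h1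
    have : (k : ℤ) ≤ f.support.card := by linarith
    exact_mod_cast this
  obtain ⟨P, hP, hPk⟩ := Finset.exists_subset_card_eq hk
  refine ⟨P, hPk, fun q hq => hmem q (hP hq), ?_⟩
  intro q hq r hr hqr e heq her
  have h1 : ∑ p ∈ ({q, r} : Finset _), f p ≤
      ∑ p ∈ f.support.filter (fun p => e ∈ p.2.2.edges), f p := by
    refine Finset.sum_le_sum_of_subset_of_nonneg ?_ (fun i _ _ => hf0 i)
    intro p hp
    rw [Finset.mem_insert, Finset.mem_singleton] at hp
    rcases hp with rfl | rfl
    · exact Finset.mem_filter.2 ⟨hP hq, heq⟩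
    · exact Finset.mem_filter.2 ⟨hP hr, her⟩
  rw [Finset.sum_pair hqr] at h1
  linarith [hedge e, hf1 q (hP hq), hf1 r (hP hr)]

/-- A walk leaving `X` uses an edge of the cut. -/
lemma exists_cross {G : SimpleGraph V} (X : Finset V) {u v : V} (w : G.Walk u v)
    (hu : u ∈ X) (hv : v ∉ X) : ∃ a b, a ∈ X ∧ b ∉ X ∧ G.Adj a b ∧ s(a, b) ∈ w.edges := by
  induction w with
  | nil => exact absurd hu hv
  | cons h p ih =>
    rename_i x y z
    by_cases hy : y ∈ X
    · obtain ⟨a, b, h1, h2, h3, h4⟩ := ih hy hv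
      exact ⟨a, b, h1, h2, h3, by simp [h4]⟩
    · exact ⟨x, y, hu, hy, h, by simp⟩

/-- If a flow exists, all cuts between a set in `X` and a set outside `X` are large. -/
lemma cut_of_flow [Fintype V] (G : SimpleGraph V) (η : ℝ)
    (A B X : Finset V) (hA : A ⊆ X) (hB : Disjoint B X)
    (hfl : HasUnitFlowIn G Finset.univ A B η) :
    (A.card : ℝ) ≤ η * cutCard G X Xᶜ := by
  obtain ⟨P, f, hf0, hfm, -, hfa, -, hfe⟩ := hfl
  set D := (X ×ˢ Xᶜ).filter (fun ab => G.Adj ab.1 ab.2) with hD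
  have h1 : (A.card : ℝ) = ∑ p ∈ P, f p := by
    rw [← Finset.sum_fiberwise_of_maps_to (s := P) (t := A) (g := fun p => p.1)
      (fun p hp => (hfm p hp).1), Finset.sum_congr rfl hfa]
    simp
  have h2 : ∑ p ∈ P, f p ≤ ∑ p ∈ P, ∑ d ∈ D, if s(d.1, d.2) ∈ p.2.2.edges then f p else 0 := by
    refine Finset.sum_le_sum fun p hp => ?_
    obtain ⟨a, b, ha, hb, hab, he⟩ := exists_cross X p.2.2 (hA (hfm p hp).1)
      (Finset.disjoint_left.1 hB (hfm p hp).2)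
    have := Finset.single_le_sum (s := D) (a := (a, b))
      (f := fun d => if s(d.1, d.2) ∈ p.2.2.edges then f p else 0)
      (fun i _ => by
        have := hf0 p hp
        split_ifs
        · exact this
        · exact le_rfl)
      (by simp [hD, ha, hb, hab])
    simpa [he] using this
  have h3 : ∑ p ∈ P, (∑ d ∈ D, if s(d.1, d.2) ∈ p.2.2.edges then f p else 0) ≤ ∑ d ∈ D, η := by
    rw [Finset.sum_comm]
    refine Finset.sum_le_sum fun d _ => ?_
    rw [← Finset.sum_filter]
    exact hfe _
  rw [Finset.sum_const, nsmul_eq_mul] at h3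
  have h4 : cutCard G X Xᶜ = D.card := rfl
  rw [h4, mul_comm]
  linarith

/-- Cut characterisation of well-linkedness, one direction. -/
lemma cut_of_wl [Fintype V] (G : SimpleGraph V) (T : Finset V) (α : ℝ) (hα : 0 < α)
    (h : WellLinked G T α) (X : Finset V) :
    α * (min (T ∩ X).card (T \ X).card : ℕ) ≤ cutCard G X Xᶜ := by
  obtain ⟨A, hA, hAc⟩ := Finset.exists_subset_card_eq
    (min_le_left (T ∩ X).card (T \ X).card)
  obtain ⟨B, hB, hBc⟩ := Finset.exists_subset_card_eq
    (min_le_right (T ∩ X).card (T \ X).card)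
  have hAX : A ⊆ X := hA.trans Finset.inter_subset_right
  have hBX : Disjoint B X := Finset.sdiff_disjoint.mono_left hB
  have := cut_of_flow G (1 / α) A B X hAX hBX
    (h A B (hA.trans Finset.inter_subset_left) (hB.trans Finset.sdiff_subset)
      (hBX.symm.mono_left hAX) (hAc.trans hBc.symm))
  rw [← hAc]
  rw [div_mul_eq_mul_div, one_mul, le_div_iff₀ hα] at this
  linarith

lemma wl_of_cut [Fintype V] (G : SimpleGraph V) (T : Finset V) (α : ℝ) (hα : 0 < α)
    (h : ∀ X : Finset V, α * (min (T ∩ X).card (T \ X).card : ℕ) ≤ cutCard G X Xᶜ) :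
    WellLinked G T α := by
  intro A B hA hB hAB hc
  refine flow_of_cut G _ (by positivity) A B hAB hc fun X => ?_
  have h1 : (A ∩ X).card + (A \ X).card = A.card := Finset.card_inter_add_card_sdiff A X
  have h2 : (B ∩ X).card + (B \ X).card = B.card := Finset.card_inter_add_card_sdiff B X
  have h3 : (A ∩ X).card ≤ (T ∩ X).card :=
    Finset.card_le_card (Finset.inter_subset_inter_right hA)
  have h4 : (B \ X).card ≤ (T \ X).card :=
    Finset.card_le_card (Finset.sdiff_subset_sdiff hB le_rfl)
  have h5 : (A ∩ X).card ≤ (B ∩ X).card + min (T ∩ X).card (T \ X).card := by omega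
  have h6 : ((A ∩ X).card : ℝ) ≤ (B ∩ X).card + (min (T ∩ X).card (T \ X).card : ℕ) := by
    exact_mod_cast h5
  have h7 : ((min (T ∩ X).card (T \ X).card : ℕ) : ℝ) ≤ 1 / α * cutCard G X Xᶜ := by
    rw [div_mul_eq_mul_div, one_mul, le_div_iff₀ hα]
    linarith [h X]
  linarith

/-! ### Cut arithmetic -/

lemma cutCard_comm (G : SimpleGraph V) (A B : Finset V) : cutCard G A B = cutCard G B A := by
  unfold cutCard
  refine Finset.card_bij (fun x _ => (x.2, x.1)) ?_ ?_ ?_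
  · intro x; simp only [Finset.mem_filter, Finset.mem_product]
    exact fun h => ⟨⟨h.1.2, h.1.1⟩, h.2.symm⟩
  · rintro ⟨a, b⟩ _ ⟨c, d⟩ _ h
    simp only [Prod.mk.injEq] at h ⊢
    tauto
  · rintro ⟨a, b⟩ h
    simp only [Finset.mem_filter, Finset.mem_product] at h
    refine ⟨(b, a), ?_, rfl⟩
    simp only [Finset.mem_filter, Finset.mem_product]
    exact ⟨⟨h.1.2, h.1.1⟩, h.2.symm⟩

lemma cutCard_union_left (G : SimpleGraph V) (A B C : Finset V) (h : Disjoint A B) :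
    cutCard G (A ∪ B) C = cutCard G A C + cutCard G B C := by
  unfold cutCard
  rw [Finset.union_product, Finset.filter_union, Finset.card_union_of_disjoint]
  refine Finset.disjoint_filter_filter ?_
  rw [Finset.disjoint_product]
  exact Or.inl h

lemma cutCard_union_right (G : SimpleGraph V) (A B C : Finset V) (h : Disjoint A B) :
    cutCard G C (A ∪ B) = cutCard G C A + cutCard G C B := by
  rw [cutCard_comm, cutCard_union_left _ _ _ _ h, cutCard_comm, cutCard_comm G B]

lemma cutCard_delete [Fintype V] (G : SimpleGraph V) (x y : V) (X : Finset V) :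
    cutCard G X Xᶜ ≤ cutCard (G.deleteEdges {s(x, y)}) X Xᶜ + 1 ∧
    ((x ∈ X ↔ y ∈ X) → cutCard G X Xᶜ ≤ cutCard (G.deleteEdges {s(x, y)}) X Xᶜ) := by
  constructor
  · unfold cutCard
    have hsub : (X ×ˢ Xᶜ).filter (fun ab => G.Adj ab.1 ab.2) ⊆
        (X ×ˢ Xᶜ).filter (fun ab => (G.deleteEdges {s(x, y)}).Adj ab.1 ab.2) ∪
        {if x ∈ X then (x, y) else (y, x)} := by
      rintro ⟨a, b⟩ h
      simp only [Finset.mem_filter, Finset.mem_product, Finset.mem_compl] at h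
      simp only [Finset.mem_union, Finset.mem_filter, Finset.mem_product, Finset.mem_compl,
        Finset.mem_singleton, SimpleGraph.deleteEdges_adj, Set.mem_singleton_iff]
      by_cases he : s(a, b) = s(x, y)
      · right
        rw [Sym2.eq_iff] at he
        rcases he with ⟨rfl, rfl⟩ | ⟨rfl, rfl⟩
        · rw [if_pos h.1.1]
        · rw [if_neg h.1.2]
      · left; exact ⟨h.1, h.2, he⟩
    refine (Finset.card_le_card hsub).trans ((Finset.card_union_le _ _).trans ?_)
    simp
  · intro hxy
    unfold cutCard
    refine Finset.card_le_card ?_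
    rintro ⟨a, b⟩ h
    simp only [Finset.mem_filter, Finset.mem_product, Finset.mem_compl] at h
    simp only [Finset.mem_filter, Finset.mem_product, Finset.mem_compl,
      SimpleGraph.deleteEdges_adj, Set.mem_singleton_iff]
    refine ⟨h.1, h.2, ?_⟩
    intro he
    rw [Sym2.eq_iff] at he
    rcases he with ⟨rfl, rfl⟩ | ⟨rfl, rfl⟩ <;> tauto

/-- Uncrossing. -/
lemma uncross [Fintype V] (G : SimpleGraph V) (X B : Finset V) :
    cutCard G (X \ B) (X \ B)ᶜ < cutCard G X Xᶜ ∨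
    cutCard G (X ∪ B) (X ∪ B)ᶜ < cutCard G X Xᶜ ∨
    (cutCard G (B ∩ X) (B ∩ X)ᶜ ≤ cutCard G B Bᶜ ∧
      cutCard G (B \ X) (B \ X)ᶜ ≤ cutCard G B Bᶜ) := by
  set P1 := B ∩ X with h1
  set P2 := B \ X with h2
  set P3 := X \ B with h3
  set P4 := (X ∪ B)ᶜ with h4
  have d12 : Disjoint P1 P2 := by
    rw [Finset.disjoint_left]; intro a; simp only [h1, h2, Finset.mem_inter, Finset.mem_sdiff]; tauto
  have d13 : Disjoint P1 P3 := by
    rw [Finset.disjoint_left]; intro a; simp only [h1, h3, Finset.mem_inter, Finset.mem_sdiff]; tauto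
  have d23 : Disjoint P2 P3 := by
    rw [Finset.disjoint_left]; intro a; simp only [h2, h3, Finset.mem_sdiff]; tauto
  have d14 : Disjoint P1 P4 := by
    rw [Finset.disjoint_left]; intro a
    simp only [h1, h4, Finset.mem_inter, Finset.mem_compl, Finset.mem_union]; tauto
  have d24 : Disjoint P2 P4 := by
    rw [Finset.disjoint_left]; intro a
    simp only [h2, h4, Finset.mem_sdiff, Finset.mem_compl, Finset.mem_union]; tauto
  have d34 : Disjoint P3 P4 := by
    rw [Finset.disjoint_left]; intro a
    simp only [h3, h4, Finset.mem_sdiff, Finset.mem_compl, Finset.mem_union]; tauto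
  have eX : X = P1 ∪ P3 := by
    ext a; simp only [h1, h3, Finset.mem_inter, Finset.mem_sdiff, Finset.mem_union]; tauto
  have eXc : Xᶜ = P2 ∪ P4 := by
    ext a; simp only [h2, h4, Finset.mem_compl, Finset.mem_sdiff, Finset.mem_union]; tauto
  have eB : B = P1 ∪ P2 := by
    ext a; simp only [h1, h2, Finset.mem_inter, Finset.mem_sdiff, Finset.mem_union]; tauto
  have eBc : Bᶜ = P3 ∪ P4 := by
    ext a; simp only [h3, h4, Finset.mem_compl, Finset.mem_sdiff, Finset.mem_union]; tauto
  have e1c : P1ᶜ = P2 ∪ (P3 ∪ P4) := by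
    ext a
    simp only [h1, h2, h3, h4, Finset.mem_compl, Finset.mem_inter, Finset.mem_sdiff,
      Finset.mem_union]
    tauto
  have e2c : P2ᶜ = P1 ∪ (P3 ∪ P4) := by
    ext a
    simp only [h1, h2, h3, h4, Finset.mem_compl, Finset.mem_inter, Finset.mem_sdiff,
      Finset.mem_union]
    tauto
  have e3c : P3ᶜ = P1 ∪ (P2 ∪ P4) := by
    ext a
    simp only [h1, h2, h3, h4, Finset.mem_compl, Finset.mem_inter, Finset.mem_sdiff,
      Finset.mem_union]
    tauto
  have eU : X ∪ B = P1 ∪ (P2 ∪ P3) := by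
    ext a
    simp only [h1, h2, h3, Finset.mem_inter, Finset.mem_sdiff, Finset.mem_union]
    tauto
  have cX : cutCard G X Xᶜ = cutCard G P1 P2 + cutCard G P1 P4 + cutCard G P2 P3
      + cutCard G P3 P4 := by
    rw [eXc, eX, cutCard_union_left _ _ _ _ d13, cutCard_union_right _ _ _ _ d24,
      cutCard_union_right _ _ _ _ d24, cutCard_comm G P3 P2]
    ring
  have cB : cutCard G B Bᶜ = cutCard G P1 P3 + cutCard G P1 P4 + cutCard G P2 P3
      + cutCard G P2 P4 := by
    rw [eBc, eB, cutCard_union_left _ _ _ _ d12, cutCard_union_right _ _ _ _ d34,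
      cutCard_union_right _ _ _ _ d34]
    ring
  have c1 : cutCard G P1 P1ᶜ = cutCard G P1 P2 + cutCard G P1 P3 + cutCard G P1 P4 := by
    rw [e1c, cutCard_union_right _ _ _ _ (Finset.disjoint_union_right.2 ⟨d23, d24⟩),
      cutCard_union_right _ _ _ _ d34]
    ring
  have c2 : cutCard G P2 P2ᶜ = cutCard G P1 P2 + cutCard G P2 P3 + cutCard G P2 P4 := by
    rw [e2c, cutCard_union_right _ _ _ _ (Finset.disjoint_union_right.2 ⟨d13, d14⟩),
      cutCard_union_right _ _ _ _ d34, cutCard_comm G P2 P1]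
    ring
  have c3 : cutCard G P3 P3ᶜ = cutCard G P1 P3 + cutCard G P2 P3 + cutCard G P3 P4 := by
    rw [e3c, cutCard_union_right _ _ _ _ (Finset.disjoint_union_right.2 ⟨d12, d14⟩),
      cutCard_union_right _ _ _ _ d24, cutCard_comm G P3 P1, cutCard_comm G P3 P2]
    ring
  have c4 : cutCard G (X ∪ B) P4 = cutCard G P1 P4 + cutCard G P2 P4 + cutCard G P3 P4 := by
    rw [eU, cutCard_union_left _ _ _ _ (Finset.disjoint_union_right.2 ⟨d12, d13⟩),
      cutCard_union_left _ _ _ _ d23]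
    ring
  rw [cX, cB, c1, c2, c3, c4]
  omega

/-- a strengthening of the deletable edge lemma.  If `T` is
`α`-well-linked in `H` with `H` edge-minimal for this property, and `Γ ⊆ V(H) \ T` is
`α'`-well-linked in `H`, then `H` contains `⌊α'|Γ|/3⌋` edge-disjoint paths connecting
vertices of `T` to vertices of `Γ`. -/
theorem stmt13 [Fintype V] (H : SimpleGraph V) (T : Finset V)
    (α : ℝ) (hα0 : 0 < α) (hα1 : α < 1)
    (hwl : WellLinked H T α)
    (hmin : ∀ e ∈ H.edgeSet, ¬ WellLinked (H.deleteEdges {e}) T α)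
    (Γ : Finset V) (hΓT : ∀ v ∈ Γ, v ∉ T)
    (α' : ℝ) (hα'0 : 0 < α') (hα'1 : α' < 1)
    (hwl' : WellLinked H Γ α') :
    ∃ P : Finset (Σ u v : V, H.Walk u v),
      P.card = Nat.floor (α' * (Γ.card : ℝ) / 3) ∧
      (∀ q ∈ P, q.2.2.IsPath ∧ q.1 ∈ T ∧ q.2.1 ∈ Γ) ∧
      (∀ q ∈ P, ∀ r ∈ P, q ≠ r → ∀ e ∈ q.2.2.edges, e ∉ r.2.2.edges) := by
  by_contra hcon
  set k := Nat.floor (α' * (Γ.card : ℝ) / 3) with hk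
  have hkle : (k : ℝ) ≤ α' * (Γ.card : ℝ) / 3 := Nat.floor_le (by positivity)
  -- a small cut, by Menger
  have hsmall : ∃ X : Finset V, T ⊆ X ∧ Disjoint Γ X ∧ cutCard H X Xᶜ < k := by
    by_contra hno
    push Not at hno
    exact hcon (menger H T Γ (Finset.disjoint_right.2 hΓT) k hno)
  obtain ⟨X0, hTX0, hΓX0, hX0⟩ := hsmall
  have hkpos : 1 ≤ k := by omega
  have hkpos' : (1 : ℝ) ≤ k := by exact_mod_cast hkpos
  have hkΓ : 3 * k ≤ Γ.card := by
    have h1 : α' * (Γ.card : ℝ) ≤ 1 * Γ.card := by gcongr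
    have h2 : (3 * k : ℝ) ≤ Γ.card := by linarith
    exact_mod_cast h2
  -- small cuts do not split Γ evenly
  have htangle : ∀ X : Finset V, cutCard H X Xᶜ < k →
      3 * (Γ ∩ X).card < Γ.card ∨ 3 * (Γ \ X).card < Γ.card := by
    intro X hX
    have h1 := cut_of_wl H Γ α' hα'0 hwl' X
    have h2 : (cutCard H X Xᶜ : ℝ) < k := by exact_mod_cast hX
    have h3 : α' * (3 * (min (Γ ∩ X).card (Γ \ X).card : ℕ) : ℝ) < α' * Γ.card := by linarith
    have h4 := lt_of_mul_lt_mul_left h3 hα'0.le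
    have h5 : 3 * min (Γ ∩ X).card (Γ \ X).card < Γ.card := by exact_mod_cast h4
    omega
  -- a minimal bad cluster
  obtain ⟨B, hB, hBmin⟩ := Finset.exists_min_image
    (Finset.univ.filter (fun B : Finset V => Disjoint T B ∧ 3 * (Γ \ B).card < Γ.card ∧
      cutCard H B Bᶜ < k)) Finset.card (by
      refine ⟨X0ᶜ, ?_⟩
      simp only [Finset.mem_filter, Finset.mem_univ, true_and]
      refine ⟨?_, ?_, ?_⟩
      · exact disjoint_compl_right.mono_left hTX0
      · have : Γ \ X0ᶜ = ∅ := by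
          rw [Finset.sdiff_eq_empty_iff_subset]
          intro x hx
          rw [Finset.mem_compl]
          exact Finset.disjoint_left.1 hΓX0 hx
        rw [this, Finset.card_empty]; omega
      · rw [cutCard_comm, compl_compl]; exact hX0)
  simp only [Finset.mem_filter, Finset.mem_univ, true_and] at hB hBmin
  obtain ⟨hTB, hΓB, hBk⟩ := hB
  have hΓB' : (Γ ∩ B).card + (Γ \ B).card = Γ.card := Finset.card_inter_add_card_sdiff Γ B
  -- an edge inside B
  have hedge : ∃ x ∈ B, ∃ y ∈ B, H.Adj x y := by
    by_contra hno
    push Not at hno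
    have hnb : ∀ v ∈ Γ ∩ B, ∃ u, u ∉ B ∧ H.Adj v u := by
      intro v hv
      rw [Finset.mem_inter] at hv
      have h1 := cut_of_wl H Γ α' hα'0 hwl' {v}
      have h2 : Γ ∩ {v} = {v} := by
        rw [Finset.inter_eq_right]; simpa using hv.1
      have h3 : (Γ ∩ {v}).card + (Γ \ {v}).card = Γ.card := Finset.card_inter_add_card_sdiff Γ _
      rw [h2, Finset.card_singleton] at h3
      have h4 : 1 ≤ min (Γ ∩ {v}).card (Γ \ {v}).card := by
        rw [h2, Finset.card_singleton]; omega
      have h5 : (1:ℝ) ≤ (min (Γ ∩ {v}).card (Γ \ {v}).card : ℕ) := by exact_mod_cast h4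
      have h6 : (0:ℝ) < cutCard H {v} {v}ᶜ := by
        refine lt_of_lt_of_le ?_ h1
        positivity
      have h7 : 0 < cutCard H {v} {v}ᶜ := by exact_mod_cast h6
      obtain ⟨⟨a, u⟩, hau⟩ := Finset.card_pos.1 h7
      simp only [Finset.mem_filter, Finset.mem_product, Finset.mem_singleton] at hau
      obtain ⟨⟨rfl, _⟩, hadj⟩ := hau
      exact ⟨u, fun hu => hno a hv.2 u hu hadj, hadj⟩
    choose! nb hnb1 hnb2 using hnb
    have : (Γ ∩ B).card ≤ cutCard H B Bᶜ := by
      unfold cutCard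
      refine Finset.card_le_card_of_injOn (fun v => (v, nb v)) ?_ ?_
      · intro v hv
        have hv' : v ∈ Γ ∩ B := hv
        simp only [Finset.coe_filter, Finset.mem_product, Finset.mem_compl, Set.mem_ofPred_eq]
        exact ⟨⟨(Finset.mem_inter.1 hv').2, hnb1 v hv'⟩, hnb2 v hv'⟩
      · intro v _ w _ h
        exact (Prod.mk.inj h).1
    omega
  obtain ⟨x, hx, y, hy, hxy⟩ := hedge
  refine hmin s(x, y) hxy (wl_of_cut _ T α hα0 fun X => ?_)
  obtain ⟨hd1, hd2⟩ := cutCard_delete H x y X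
  by_cases hsame : x ∈ X ↔ y ∈ X
  · refine (cut_of_wl H T α hα0 hwl X).trans ?_
    exact_mod_cast hd2 hsame
  -- it suffices to find a smaller cut with the same trace on T
  have hsuff : ∀ X' : Finset V, (∀ t ∈ T, t ∈ X' ↔ t ∈ X) →
      cutCard H X' X'ᶜ < cutCard H X Xᶜ →
      α * (min (T ∩ X).card (T \ X).card : ℕ) ≤
        cutCard (H.deleteEdges {s(x, y)}) X Xᶜ := by
    intro X' hX' hlt
    have e1 : T ∩ X' = T ∩ X := by
      ext t; simp only [Finset.mem_inter]
      exact ⟨fun h => ⟨h.1, (hX' t h.1).1 h.2⟩, fun h => ⟨h.1, (hX' t h.1).2 h.2⟩⟩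
    have e2 : T \ X' = T \ X := by
      ext t; simp only [Finset.mem_sdiff]
      exact ⟨fun h => ⟨h.1, fun h' => h.2 ((hX' t h.1).2 h')⟩,
        fun h => ⟨h.1, fun h' => h.2 ((hX' t h.1).1 h')⟩⟩
    have := cut_of_wl H T α hα0 hwl X'
    rw [e1, e2] at this
    refine this.trans ?_
    have : cutCard H X' X'ᶜ ≤ cutCard (H.deleteEdges {s(x, y)}) X Xᶜ := by omega
    exact_mod_cast this
  have hTB' : ∀ t ∈ T, t ∉ B := fun t ht => Finset.disjoint_left.1 hTB ht
  rcases uncross H X B with h | h | ⟨h1, h2⟩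
  · refine hsuff _ (fun t ht => ?_) h
    have := hTB' t ht
    simp [this]
  · refine hsuff _ (fun t ht => ?_) h
    have := hTB' t ht
    simp [this]
  · exfalso
    have hs1 : B ∩ X ⊂ B := by
      refine (Finset.ssubset_iff_of_subset Finset.inter_subset_left).2 ?_
      by_cases hxX : x ∈ X
      · exact ⟨y, hy, by simp only [Finset.mem_inter]; tauto⟩
      · exact ⟨x, hx, by simp only [Finset.mem_inter]; tauto⟩
    have hs2 : B \ X ⊂ B := by
      refine (Finset.ssubset_iff_of_subset Finset.sdiff_subset).2 ?_
      by_cases hxX : x ∈ X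
      · exact ⟨x, hx, by simp only [Finset.mem_sdiff]; tauto⟩
      · exact ⟨y, hy, by simp only [Finset.mem_sdiff]; tauto⟩
    have hnb : ∀ C : Finset V, C ⊂ B → cutCard H C Cᶜ ≤ cutCard H B Bᶜ →
        3 * (Γ ∩ C).card < Γ.card := by
      intro C hC hle
      rcases htangle C (by omega) with h | h
      · exact h
      · have := hBmin C ⟨hTB.mono_right hC.subset, h, by omega⟩
        have := Finset.card_lt_card hC
        omega
    have g1 := hnb _ hs1 h1
    have g2 := hnb _ hs2 h2
    have g3 : (Γ ∩ B).card ≤ (Γ ∩ (B ∩ X)).card + (Γ ∩ (B \ X)).card := by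
      refine (Finset.card_le_card ?_).trans (Finset.card_union_le _ _)
      intro v
      simp only [Finset.mem_inter, Finset.mem_union, Finset.mem_sdiff]
      tauto
    omega
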